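/- For every point (c₂ : c₂') ∈ ℂP¹, the point p = ((1:0), (c₂:c₂'), (0:1)) of ℂP¹ × ℂP¹ × ℂP¹ lies in the closure of F, and the map φ (defined on F) tends to the point ((1:1), (c₂ : c₂ − c₂'), (c₂ : c₂ − c₂')) along the filter of neighborhoods of p within F (nhdsWithin p F). (The homeomorphism f₁₂,₁₃ extends continuously to the boundary set F̄^{1'3} = {((1:0), (c₂:c₂'), (0:1))} by the formula ((1:0),(c₂:c₂'),(0:1)) ↦ ((1:1),(c₂:c₂−c₂'),(c₂:c₂−c₂')).) -/

import Mathlib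

open scoped LinearAlgebra.Projectivization

/-- The quotient topology on the complex projective line. -/
noncomputable instance : TopologicalSpace (ℙ ℂ (Fin 2 → ℂ)) := instTopologicalSpaceQuotient

/-- The point of the complex projective line with homogeneous coordinates `(a : b)`. -/
noncomputable def pt (a b : ℂ) (h : a ≠ 0 ∨ b ≠ 0) : ℙ ℂ (Fin 2 → ℂ) :=
  Projectivization.mk ℂ ![a, b] (fun hz => by
    rcases h with h | h
    · exact h (by simpa using congrFun hz 0)
    · exact h (by simpa using congrFun hz 1))

/-- The point `(a : b)` of `ℂP¹` for possibly degenerate data (junk value `(1:0)` if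
`a = b = 0`). -/
noncomputable def pt' (a b : ℂ) : ℙ ℂ (Fin 2 → ℂ) :=
  if h : a ≠ 0 ∨ b ≠ 0 then pt a b h else pt 1 0 (Or.inl one_ne_zero)

/-- The space of parameters `F` of the main stratum of `G_{5,2}`, as a subset of
`ℂP¹ × ℂP¹ × ℂP¹`: triples `((c₁:c₁'), (c₂:c₂'), (c₃:c₃'))` with `c₁c₂'c₃ = c₁'c₂c₃'` and
`cᵢ, cᵢ' ≠ 0`, `cᵢ ≠ cᵢ'`. -/
def Fset : Set (ℙ ℂ (Fin 2 → ℂ) × ℙ ℂ (Fin 2 → ℂ) × ℙ ℂ (Fin 2 → ℂ)) :=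
  {p | ∃ (c₁ c₁' c₂ c₂' c₃ c₃' : ℂ) (h₁ : c₁ ≠ 0) (h₂ : c₂ ≠ 0) (h₃ : c₃ ≠ 0),
    c₁' ≠ 0 ∧ c₂' ≠ 0 ∧ c₃' ≠ 0 ∧ c₁ ≠ c₁' ∧ c₂ ≠ c₂' ∧ c₃ ≠ c₃' ∧
    c₁ * c₂' * c₃ = c₁' * c₂ * c₃' ∧
    p = (pt c₁ c₁' (Or.inl h₁), pt c₂ c₂' (Or.inl h₂), pt c₃ c₃' (Or.inl h₃))}

/-- The transition map `φ = f₁₂,₁₃`,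
`((c₁:c₁'), (c₂:c₂'), (c₃:c₃')) ↦ ((c₁ : c₁-c₁'), (c₂ : c₂-c₂'), ((c₁-c₁')c₂'c₃ : c₁'(c₂-c₂')c₃'))`,
written in terms of chosen homogeneous representatives; its restriction to the space of
parameters `F` (where the formula is independent of the chosen representatives) is the
transition homeomorphism between the charts `M₁₂` and `M₁₃` of `G_{5,2}`. -/
noncomputable def phiFun (p : ℙ ℂ (Fin 2 → ℂ) × ℙ ℂ (Fin 2 → ℂ) × ℙ ℂ (Fin 2 → ℂ)) :
    ℙ ℂ (Fin 2 → ℂ) × ℙ ℂ (Fin 2 → ℂ) × ℙ ℂ (Fin 2 → ℂ) :=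
  (pt' (p.1.rep 0) (p.1.rep 0 - p.1.rep 1),
   pt' (p.2.1.rep 0) (p.2.1.rep 0 - p.2.1.rep 1),
   pt' ((p.1.rep 0 - p.1.rep 1) * p.2.1.rep 1 * p.2.2.rep 0)
       (p.1.rep 1 * (p.2.1.rep 0 - p.2.1.rep 1) * p.2.2.rep 1))

open Filter Topology

theorem pt'_of (a b : ℂ) (h : a ≠ 0 ∨ b ≠ 0) : pt' a b = pt a b h := by
  simp [pt', h]

theorem pt'_smul (k a b : ℂ) (hk : k ≠ 0) : pt' (k * a) (k * b) = pt' a b := by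
  by_cases h : a ≠ 0 ∨ b ≠ 0
  · have h' : k * a ≠ 0 ∨ k * b ≠ 0 := by simpa [hk] using h
    rw [pt'_of _ _ h, pt'_of _ _ h']
    unfold pt
    rw [Projectivization.mk_eq_mk_iff']
    exact ⟨k, by ext i; fin_cases i <;> simp⟩
  · have h' : ¬ (k * a ≠ 0 ∨ k * b ≠ 0) := by simpa [hk] using h
    simp only [pt', dif_neg h, dif_neg h']

theorem rep_pt (a b : ℂ) (h : a ≠ 0 ∨ b ≠ 0) :
    ∃ k : ℂ, k ≠ 0 ∧ (pt a b h).rep 0 = k * a ∧ (pt a b h).rep 1 = k * b := by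
  unfold pt
  obtain ⟨k, hk⟩ := Projectivization.exists_smul_eq_mk_rep ℂ ![a, b] (fun hz => by
    rcases h with h | h
    · exact h (by simpa using congrFun hz 0)
    · exact h (by simpa using congrFun hz 1))
  refine ⟨k, k.ne_zero, ?_, ?_⟩
  · rw [← hk]; simp [Units.smul_def]
  · rw [← hk]; simp [Units.smul_def]

theorem eventually_ne (a b : ℂ) (h : a ≠ 0 ∨ b ≠ 0) :
    ∀ᶠ v : ℂ × ℂ in 𝓝 (a, b), v.1 ≠ 0 ∨ v.2 ≠ 0 := by
  rcases h with h | h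
  · exact (continuousAt_fst.eventually_ne h).mono fun v hv => Or.inl hv
  · exact (continuousAt_snd.eventually_ne h).mono fun v hv => Or.inr hv

theorem nz_of (v : ℂ × ℂ) (h : v.1 ≠ 0 ∨ v.2 ≠ 0) : (![v.1, v.2] : Fin 2 → ℂ) ≠ 0 := by
  intro hz
  rcases h with h | h
  · exact h (by simpa using congrFun hz 0)
  · exact h (by simpa using congrFun hz 1)

theorem isOpen_proj (T : Set (ℙ ℂ (Fin 2 → ℂ))) :
    IsOpen T ↔ IsOpen {w : {v : Fin 2 → ℂ // v ≠ 0} | Projectivization.mk ℂ w.1 w.2 ∈ T} :=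
  Iff.rfl

theorem tendsto_pt (a b : ℂ) (h : a ≠ 0 ∨ b ≠ 0) :
    Tendsto (fun v : ℂ × ℂ => pt' v.1 v.2) (𝓝 (a, b)) (𝓝 (pt a b h)) := by
  rw [tendsto_nhds]
  intro T hT hmem
  rw [isOpen_proj, isOpen_induced_iff] at hT
  obtain ⟨U, hU, hUT⟩ := hT
  have key : ∀ (v : ℂ × ℂ) (hv : v.1 ≠ 0 ∨ v.2 ≠ 0), pt v.1 v.2 hv ∈ T ↔ ![v.1, v.2] ∈ U := by
    intro v hv
    have := Set.ext_iff.1 hUT ⟨![v.1, v.2], nz_of v hv⟩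
    exact this.symm
  have hc : Continuous (fun v : ℂ × ℂ => (![v.1, v.2] : Fin 2 → ℂ)) := by
    fun_prop
  have h1 : ∀ᶠ v : ℂ × ℂ in 𝓝 (a, b), ![v.1, v.2] ∈ U :=
    hc.continuousAt.eventually (hU.mem_nhds ((key (a, b) h).1 hmem))
  filter_upwards [h1, eventually_ne a b h] with v hv hv'
  show pt' v.1 v.2 ∈ T
  rw [pt'_of _ _ hv', key v hv']
  exact hv

theorem nhds_le (a b : ℂ) (h : a ≠ 0 ∨ b ≠ 0) :
    𝓝 (pt a b h) ≤ map (fun v : ℂ × ℂ => pt' v.1 v.2) (𝓝 (a, b)) := by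
  intro S hS
  rw [mem_map, mem_nhds_iff] at hS
  obtain ⟨U, hUS, hU, hab⟩ := hS
  rw [mem_nhds_iff]
  refine ⟨{q | ∃ v ∈ U, ∃ hv : v.1 ≠ 0 ∨ v.2 ≠ 0, q = pt v.1 v.2 hv}, ?_, ?_, ⟨(a, b), hab, h, rfl⟩⟩
  · rintro q ⟨v, hv, hv', rfl⟩
    have := hUS hv
    rwa [Set.mem_preimage, pt'_of _ _ hv'] at this
  · rw [isOpen_proj]
    have : {w : {v : Fin 2 → ℂ // v ≠ 0} | Projectivization.mk ℂ w.1 w.2 ∈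
        {q | ∃ v ∈ U, ∃ hv : v.1 ≠ 0 ∨ v.2 ≠ 0, q = pt v.1 v.2 hv}} =
        ⋃ k : ℂˣ, {w : {v : Fin 2 → ℂ // v ≠ 0} | ((k : ℂ) * w.1 0, (k : ℂ) * w.1 1) ∈ U} := by
      ext w
      simp only [Set.mem_ofPred_eq, Set.mem_iUnion]
      constructor
      · rintro ⟨v, hv, hv', he⟩
        rw [eq_comm] at he
        unfold pt at he
        rw [Projectivization.mk_eq_mk_iff] at he
        obtain ⟨k, hk⟩ := he
        refine ⟨k, ?_⟩
        have h0 := congrFun hk 0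
        have h1 := congrFun hk 1
        simp [Units.smul_def] at h0 h1
        rw [h0, h1]; exact hv
      · rintro ⟨k, hk⟩
        have hw : w.1 0 ≠ 0 ∨ w.1 1 ≠ 0 := by
          by_contra! hc
          exact w.2 (by ext i; fin_cases i <;> simp [hc.1, hc.2])
        refine ⟨_, hk, by simpa using hw, ?_⟩
        unfold pt
        rw [eq_comm, Projectivization.mk_eq_mk_iff]
        exact ⟨k, by ext i; fin_cases i <;> simp [Units.smul_def]⟩
    rw [this]
    refine isOpen_iUnion fun k => hU.preimage (f := fun w : {v : Fin 2 → ℂ // v ≠ 0} =>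
      ((k : ℂ) * w.1 0, (k : ℂ) * w.1 1)) ?_
    have hc : ∀ i : Fin 2, Continuous fun w : {v : Fin 2 → ℂ // v ≠ 0} => w.1 i :=
      fun i => (continuous_apply i).comp continuous_subtype_val
    exact (continuous_const.mul (hc 0)).prodMk (continuous_const.mul (hc 1))

theorem tendsto_pt' {X : Type*} {l : Filter X} {f g : X → ℂ} {a b : ℂ} (h : a ≠ 0 ∨ b ≠ 0)
    (hf : Tendsto f l (𝓝 a)) (hg : Tendsto g l (𝓝 b)) :
    Tendsto (fun x => pt' (f x) (g x)) l (𝓝 (pt a b h)) :=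
  (tendsto_pt a b h).comp (hf.prodMk_nhds hg)

/-- The simplified formula for the transition map. -/
noncomputable def psiFun (p : ℙ ℂ (Fin 2 → ℂ) × ℙ ℂ (Fin 2 → ℂ) × ℙ ℂ (Fin 2 → ℂ)) :
    ℙ ℂ (Fin 2 → ℂ) × ℙ ℂ (Fin 2 → ℂ) × ℙ ℂ (Fin 2 → ℂ) :=
  (pt' (p.1.rep 0) (p.1.rep 0 - p.1.rep 1),
   pt' (p.2.1.rep 0) (p.2.1.rep 0 - p.2.1.rep 1),
   pt' ((p.1.rep 0 - p.1.rep 1) * p.2.1.rep 0)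
       (p.1.rep 0 * (p.2.1.rep 0 - p.2.1.rep 1)))

theorem phi_eq_psi (p) (hp : p ∈ Fset) : phiFun p = psiFun p := by
  obtain ⟨c₁, c₁', c₂, c₂', c₃, c₃', h₁, h₂, h₃, h₁', h₂', h₃', -, -, -, he, rfl⟩ := hp
  obtain ⟨k, hk, e1, e2⟩ := rep_pt c₁ c₁' (Or.inl h₁)
  obtain ⟨l, hl, e3, e4⟩ := rep_pt c₂ c₂' (Or.inl h₂)
  obtain ⟨m, hm, e5, e6⟩ := rep_pt c₃ c₃' (Or.inl h₃)
  simp only [phiFun, psiFun, e1, e2, e3, e4, e5, e6]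
  congr 2
  rw [← pt'_smul (c₁' * m * c₃' / c₁) ((k * c₁ - k * c₁') * (l * c₂)) _ (by positivity)]
  congr 1
  · field_simp
    linear_combination (c₁ - c₁') * he
  · field_simp

theorem psi_pt (u v : ℂ × ℂ) (hu : u.1 ≠ 0 ∨ u.2 ≠ 0) (hv : v.1 ≠ 0 ∨ v.2 ≠ 0) (q) :
    psiFun (pt' u.1 u.2, pt' v.1 v.2, q) =
      (pt' u.1 (u.1 - u.2), pt' v.1 (v.1 - v.2), pt' ((u.1 - u.2) * v.1) (u.1 * (v.1 - v.2))) := by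
  obtain ⟨k, hk, e1, e2⟩ := rep_pt u.1 u.2 hu
  obtain ⟨l, hl, e3, e4⟩ := rep_pt v.1 v.2 hv
  simp only [psiFun, pt'_of _ _ hu, pt'_of _ _ hv, e1, e2, e3, e4]
  rw [← mul_sub, ← mul_sub, pt'_smul _ _ _ hk, pt'_smul _ _ _ hl,
    ← pt'_smul (k * l) ((u.1 - u.2) * v.1) _ (mul_ne_zero hk hl)]
  congr 3 <;> ring

theorem ev_ne (a k : ℂ) (hk : k ≠ 0) : ∀ᶠ t : ℂ in 𝓝[≠] 0, a + k * t ≠ 0 := by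
  by_cases ha : a = 0
  · filter_upwards [self_mem_nhdsWithin] with t ht
    simpa [ha, hk] using ht
  · have : ContinuousAt (fun t : ℂ => a + k * t) 0 := by fun_prop
    exact nhdsWithin_le_nhds (this.eventually_ne (by simpa using ha))

theorem mem_clos (c₂ c₂' : ℂ) (h : c₂ ≠ 0 ∨ c₂' ≠ 0) :
    (pt 1 0 (Or.inl one_ne_zero), pt c₂ c₂' h, pt 0 1 (Or.inr one_ne_zero)) ∈ closure Fset := by
  have tt : ∀ (f : ℂ → ℂ) (x : ℂ), Continuous f → f 0 = x → Tendsto f (𝓝[≠] 0) (𝓝 x) := by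
    rintro f x hf rfl
    exact hf.continuousAt.tendsto.mono_left nhdsWithin_le_nhds
  have T : Tendsto (fun t : ℂ => (pt' 1 (t * (c₂' + 2 * t)), pt' (c₂ + 1 * t) (c₂' + 2 * t),
      pt' (t * (c₂ + 1 * t)) 1)) (𝓝[≠] 0)
      (𝓝 (pt 1 0 (Or.inl one_ne_zero), pt c₂ c₂' h, pt 0 1 (Or.inr one_ne_zero))) := by
    refine Tendsto.prodMk_nhds ?_ (Tendsto.prodMk_nhds ?_ ?_) <;> apply tendsto_pt' <;>
      exact tt _ _ (by fun_prop) (by simp)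
  refine mem_closure_of_tendsto T ?_
  have n1 : ∀ᶠ t : ℂ in 𝓝[≠] 0, t * (c₂' + 2 * t) ≠ 1 :=
    (tt (fun t => t * (c₂' + 2 * t)) 0 (by fun_prop) (by simp)).eventually_ne zero_ne_one
  have n2 : ∀ᶠ t : ℂ in 𝓝[≠] 0, t * (c₂ + 1 * t) ≠ 1 :=
    (tt (fun t => t * (c₂ + 1 * t)) 0 (by fun_prop) (by simp)).eventually_ne zero_ne_one
  filter_upwards [n1, n2, ev_ne c₂ 1 one_ne_zero, ev_ne c₂' 2 two_ne_zero,
    ev_ne (c₂ - c₂') (-1) (by simp), self_mem_nhdsWithin] with t h1 h2 h3 h4 h5 h6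
  have h6 : t ≠ 0 := h6
  refine ⟨1, t * (c₂' + 2 * t), c₂ + 1 * t, c₂' + 2 * t, t * (c₂ + 1 * t), 1, one_ne_zero, h3,
    mul_ne_zero h6 h3, mul_ne_zero h6 h4, h4, one_ne_zero, h1.symm, ?_, h2, by ring, ?_⟩
  · intro he
    exact h5 (by linear_combination he)
  · rw [pt'_of _ _ (Or.inl one_ne_zero), pt'_of _ _ (Or.inl h3), pt'_of _ _ (Or.inr one_ne_zero)]

/-- For every `(c₂ : c₂') ∈ ℂP¹`, the point `p = ((1:0), (c₂:c₂'), (0:1))` lies in the closure of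
the space of parameters `F` of the main stratum of `G_{5,2}`, and the transition map
`φ = f₁₂,₁₃` tends to `((1:1), (c₂ : c₂-c₂'), (c₂ : c₂-c₂'))` along the neighborhoods of `p`
within `F`. -/
theorem transition_extends_to_boundary_piece (c₂ c₂' : ℂ) (h : c₂ ≠ 0 ∨ c₂' ≠ 0) :
    (pt 1 0 (Or.inl one_ne_zero), pt c₂ c₂' h, pt 0 1 (Or.inr one_ne_zero)) ∈ closure Fset ∧
    Filter.Tendsto phiFun
      (nhdsWithin (pt 1 0 (Or.inl one_ne_zero), pt c₂ c₂' h, pt 0 1 (Or.inr one_ne_zero)) Fset)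
      (nhds (pt 1 1 (Or.inl one_ne_zero),
        pt c₂ (c₂ - c₂') (by
          rcases h with h' | h'
          · exact Or.inl h'
          · by_cases hc : c₂ = 0
            · exact Or.inr (by rw [hc, zero_sub]; exact neg_ne_zero.mpr h')
            · exact Or.inl hc),
        pt c₂ (c₂ - c₂') (by
          rcases h with h' | h'
          · exact Or.inl h'
          · by_cases hc : c₂ = 0
            · exact Or.inr (by rw [hc, zero_sub]; exact neg_ne_zero.mpr h')
            · exact Or.inl hc))) := by
  refine ⟨mem_clos c₂ c₂' h, ?_⟩
  have hs : c₂ ≠ 0 ∨ c₂ - c₂' ≠ 0 := by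
    by_contra! hc
    obtain ⟨h1, h2⟩ := hc
    simp_all
  refine Tendsto.congr' (f₁ := psiFun) ?_ ?_
  · filter_upwards [self_mem_nhdsWithin] with p hp using (phi_eq_psi p hp).symm
  refine Tendsto.mono_left ?_ nhdsWithin_le_nhds
  rw [nhds_prod_eq, nhds_prod_eq (x := pt c₂ c₂' h)]
  refine Tendsto.mono_left ?_ (Filter.prod_mono (nhds_le 1 0 (Or.inl one_ne_zero))
    (Filter.prod_mono_left _ (nhds_le c₂ c₂' h)))
  rw [← Filter.map_id (f := 𝓝 (pt 0 1 (Or.inr one_ne_zero))), Filter.prod_map_map_eq,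
    Filter.prod_map_map_eq, tendsto_map'_iff]
  have tu : Tendsto (fun x : (ℂ × ℂ) × (ℂ × ℂ) × ℙ ℂ (Fin 2 → ℂ) => x.1)
      (𝓝 ((1 : ℂ), (0 : ℂ)) ×ˢ (𝓝 (c₂, c₂') ×ˢ 𝓝 (pt 0 1 (Or.inr one_ne_zero)))) (𝓝 (1, 0)) :=
    tendsto_fst
  have tv : Tendsto (fun x : (ℂ × ℂ) × (ℂ × ℂ) × ℙ ℂ (Fin 2 → ℂ) => x.2.1)
      (𝓝 ((1 : ℂ), (0 : ℂ)) ×ˢ (𝓝 (c₂, c₂') ×ˢ 𝓝 (pt 0 1 (Or.inr one_ne_zero)))) (𝓝 (c₂, c₂')) :=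
    tendsto_fst.comp tendsto_snd
  have u1 := (continuous_fst.tendsto _).comp tu
  have u2 := (continuous_snd.tendsto _).comp tu
  have v1 := (continuous_fst.tendsto _).comp tv
  have v2 := (continuous_snd.tendsto _).comp tv
  refine Tendsto.congr' (f₁ := fun x : (ℂ × ℂ) × (ℂ × ℂ) × ℙ ℂ (Fin 2 → ℂ) =>
    (pt' x.1.1 (x.1.1 - x.1.2), pt' x.2.1.1 (x.2.1.1 - x.2.1.2),
      pt' ((x.1.1 - x.1.2) * x.2.1.1) (x.1.1 * (x.2.1.1 - x.2.1.2)))) ?_ ?_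
  · filter_upwards [tu.eventually (eventually_ne 1 0 (Or.inl one_ne_zero)),
      tv.eventually (eventually_ne c₂ c₂' h)] with x hx hy
    exact (psi_pt x.1 x.2.1 hx hy x.2.2).symm
  · refine Tendsto.prodMk_nhds ?_ (Tendsto.prodMk_nhds ?_ ?_)
    · exact tendsto_pt' _ u1 (by simpa using u1.sub u2)
    · exact tendsto_pt' _ v1 (v1.sub v2)
    · exact tendsto_pt' _ (by simpa using (u1.sub u2).mul v1) (by simpa using u1.mul (v1.sub v2))
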